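/- arXiv:2108.08613 — 3 statements merged into one kernel-verified Lean document; each statement's English description precedes it below -/
import Mathlib

section
/- Let d ≥ 1 and let a, b ∈ {0,1}^d. The binary string p'(b) is a subsequence of the binary string s'(a) if and only if a and b are orthogonal (i.e., a[i]·b[i] = 0 for every coordinate i). -/
/- Binary strings are lists of Booleans: `false` is the character 0 and
`true` is the character 1. -/

/-- The coordinate gadget: s(a[i]) = 01 if a[i] = 0, and 00 if a[i] = 1. -/
def coordGadget (v : Bool) : List Bool :=
  if v then [false, false] else [false, true]

/-- The inner separator gadget 0^d. -/
def innerSep (d : ℕ) : List Bool := List.replicate d false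

/-- The outer separator gadget 1^(d+1). -/
def outerSep (d : ℕ) : List Bool := List.replicate (d + 1) true

/-- p'(b) = 0^d b[1] 0^d b[2] 0^d ⋯ 0^d b[d] 0^d. -/
def pStr' {d : ℕ} (b : Fin d → Bool) : List Bool :=
  innerSep d ++ (List.ofFn fun i => [b i] ++ innerSep d).flatten

/-- s'(a) = 0^d s(a[1]) 0^d s(a[2]) 0^d ⋯ 0^d s(a[d]) 0^d. -/
def sStr' {d : ℕ} (a : Fin d → Bool) : List Bool :=
  innerSep d ++ (List.ofFn fun i => coordGadget (a i) ++ innerSep d).flatten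

/-- The all-zeros vector z ∈ {0,1}^d. -/
def zVec (d : ℕ) : Fin d → Bool := fun _ => false

/-- Two vectors a, b ∈ {0,1}^d are orthogonal if a[i]·b[i] = 0 for all i. -/
def Orthogonal {d : ℕ} (a b : Fin d → Bool) : Prop :=
  ∀ i, (a i && b i) = false

/-- The pattern P' = 1^(d+1) p'(b₁) 1^(d+1) p'(b₂) 1^(d+1) ⋯ 1^(d+1) p'(bₘ) 1^(d+1). -/
def Pstr' {d m : ℕ} (B : Fin m → Fin d → Bool) : List Bool :=
  outerSep d ++ (List.ofFn fun j => pStr' (B j) ++ outerSep d).flatten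

/-- One copy of the concatenation
s'(a₁) 1^(d+1) s'(z) 1^(d+1) ⋯ s'(aₙ) 1^(d+1) s'(z) 1^(d+1). -/
def Shalf' {d n : ℕ} (A : Fin n → Fin d → Bool) : List Bool :=
  (List.ofFn fun i =>
    sStr' (A i) ++ outerSep d ++ sStr' (zVec d) ++ outerSep d).flatten

/-- The text S' = 1^(d+1) s'(z) 1^(d+1) followed by two consecutive copies of
s'(a₁) 1^(d+1) s'(z) 1^(d+1) ⋯ s'(aₙ) 1^(d+1) s'(z) 1^(d+1). -/
def Sstr' {d n : ℕ} (A : Fin n → Fin d → Bool) : List Bool :=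
  outerSep d ++ sStr' (zVec d) ++ outerSep d ++ Shalf' A ++ Shalf' A

theorem List.Sublist.of_cons_replicate_append {α : Type*} {x y : α} (hxy : x ≠ y)
    {l₁ l₂ : List α} {k : ℕ} (h : (x :: l₁).Sublist (List.replicate k y ++ l₂)) :
    (x :: l₁).Sublist l₂ := by
  induction k with
  | zero => simpa using h
  | succ k ih =>
    rw [List.replicate_succ, List.cons_append] at h
    cases h with
    | cons _ h => exact ih h
    | cons_cons _ h => exact absurd rfl hxy

theorem length_flatten_coordGadget (D : ℕ) {n : ℕ} (a : Fin n → Bool) :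
    (List.ofFn fun i => coordGadget (a i) ++ innerSep D).flatten.length = n * (D + 2) := by
  induction n with
  | zero => simp
  | succ n ih =>
    have hs : (innerSep D).length = D := by simp [innerSep]
    have hg : (coordGadget (a 0)).length = 2 := by cases a 0 <;> rfl
    simp only [List.ofFn_succ, List.flatten_cons, List.length_append, ih, hg, hs]
    ring

theorem length_flatten_bit (D : ℕ) {n : ℕ} (b : Fin n → Bool) :
    (List.ofFn fun i => [b i] ++ innerSep D).flatten.length = n * (D + 1) := by
  induction n with
  | zero => simp
  | succ n ih =>
    have hs : (innerSep D).length = D := by simp [innerSep]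
    simp only [List.ofFn_succ, List.flatten_cons, List.length_append, ih, hs,
      List.length_singleton]
    ring

theorem flatten_bit_sublist_flatten_coordGadget (D : ℕ) {n : ℕ} {a b : Fin n → Bool}
    (h : Orthogonal a b) :
    (List.ofFn fun i => [b i] ++ innerSep D).flatten.Sublist
      (List.ofFn fun i => coordGadget (a i) ++ innerSep D).flatten := by
  induction n with
  | zero => simp
  | succ n ih =>
    simp only [List.ofFn_succ, List.flatten_cons]
    have h0 : [b 0].Sublist (coordGadget (a 0)) := by
      have := h 0
      revert this
      cases a 0 <;> cases b 0 <;> simp [coordGadget]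
    exact (h0.append (List.Sublist.refl _)).append (ih fun i => h i.succ)

/-- The separators absorb a surplus of `t` zeros in front of the text as long as `t` plus the
number of remaining coordinates does not exceed the separator length. -/
theorem orthogonal_of_flatten_bit_sublist {D n t : ℕ} (ht : t + n ≤ D) {a b : Fin n → Bool}
    (h : (List.ofFn fun i => [b i] ++ innerSep D).flatten.Sublist
      (List.replicate t false ++
        (List.ofFn fun i => coordGadget (a i) ++ innerSep D).flatten)) :
    Orthogonal a b := by
  induction n generalizing t with
  | zero => exact fun i => i.elim0
  | succ n ih =>
    simp only [List.ofFn_succ, List.flatten_cons] at h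
    have hS := length_flatten_coordGadget D fun i => a i.succ
    have hP := length_flatten_bit D fun i => b i.succ
    have ih' := fun s (hs : s + n ≤ D) => @ih s hs (fun i => a i.succ) (fun i => b i.succ)
    generalize (List.ofFn fun i : Fin n => coordGadget (a i.succ) ++ innerSep D).flatten = S at *
    generalize (List.ofFn fun i : Fin n => [b i.succ] ++ innerSep D).flatten = P at *
    suffices (a 0 && b 0) = false ∧ Orthogonal (fun i => a i.succ) (fun i => b i.succ) from
      fun i => Fin.cases this.1 this.2 i
    cases ha : a 0 <;> cases hb : b 0 <;>
      simp only [ha, hb, coordGadget, innerSep, Bool.false_eq_true, if_true, if_false] at h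
    · refine ⟨rfl, ih' t (by omega) ?_⟩
      obtain ⟨k, rfl⟩ : ∃ k, D = t + (k + 1) := ⟨D - t - 1, by omega⟩
      have h1 : (List.replicate (t + 1) false ++ (false :: (List.replicate k false ++ P))).Sublist
          (List.replicate (t + 1) false ++
            (true :: (List.replicate (t + (k + 1)) false ++ S))) := by
        convert h using 1
        · rw [← List.cons_append, ← List.replicate_succ, ← List.append_assoc,
            ← List.replicate_add, List.singleton_append, ← List.replicate_succ]
          congr 2
          omega
        · simp [List.replicate_succ']
      rw [List.append_sublist_append_left] at h1
      have h2 := List.Sublist.of_cons_replicate_append (k := 1) (y := true) (by simp) h1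
      have h3 : (List.replicate (k + 1) false ++ P).Sublist
          (List.replicate (k + 1) false ++ (List.replicate t false ++ S)) := by
        rw [← List.append_assoc, ← List.replicate_add, Nat.add_comm (k + 1) t]
        exact h2
      exact (List.append_sublist_append_left _).1 h3
    · refine ⟨rfl, ih' 0 (by omega) ?_⟩
      have h1 : (true :: (List.replicate D false ++ P)).Sublist
          (List.replicate (t + 1) false ++ (true :: (List.replicate D false ++ S))) := by
        simpa [List.replicate_add] using h
      have h2 := List.cons_sublist_cons.1 (h1.of_cons_replicate_append (by simp))
      simpa using (List.append_sublist_append_left _).1 h2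
    · refine ⟨rfl, ih' (t + 1) (by omega) ?_⟩
      have h1 : (List.replicate (D + 1) false ++ P).Sublist
          (List.replicate (D + 1) false ++ (List.replicate (t + 1) false ++ S)) := by
        rw [← List.append_assoc (List.replicate (D + 1) false), ← List.replicate_add,
          show D + 1 + (t + 1) = t + (2 + D) by omega]
        simpa [List.replicate_add, List.replicate_succ] using h
      exact (List.append_sublist_append_left _).1 h1
    · exfalso
      have h1 : (true :: (List.replicate D false ++ P)).Sublist
          (List.replicate (t + (2 + D)) false ++ S) := by
        simpa [List.replicate_add, List.replicate_succ] using h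
      have h2 := (h1.of_cons_replicate_append (by simp)).length_le
      simp only [List.length_cons, List.length_append, List.length_replicate, hP, hS] at h2
      nlinarith

/-- For d ≥ 1 and a, b ∈ {0,1}^d, the binary string p'(b) is a subsequence of
the binary string s'(a) if and only if a and b are orthogonal. -/
theorem pStr'_sublist_sStr'_iff_orthogonal {d : ℕ} (hd : 1 ≤ d)
    (a b : Fin d → Bool) :
    (pStr' b).Sublist (sStr' a) ↔ Orthogonal a b := by
  unfold pStr' sStr'
  rw [List.append_sublist_append_left]
  exact ⟨fun h => orthogonal_of_flatten_bit_sublist (t := 0) (Nat.zero_add d).le h,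
    flatten_bit_sublist_flatten_coordGadget d⟩
end

section
/- Let d ≥ 1 and let z ∈ {0,1}^d be the all-zeros vector. For every vector b ∈ {0,1}^d, the binary string p'(b) is a subsequence of the binary string s'(z). -/
/-- Pointwise sublists between two finite families of lists concatenate to a sublist. -/
theorem List.flatten_ofFn_sublist {α : Type*} {n : ℕ} {f g : Fin n → List α}
    (h : ∀ i, (f i).Sublist (g i)) :
    (List.ofFn f).flatten.Sublist (List.ofFn g).flatten := by
  induction n with
  | zero => simp
  | succ n ih =>
    simp only [List.ofFn_succ, List.flatten_cons]
    exact (h 0).append (ih fun i => h i.succ)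

/-- Either character is a subsequence of the coordinate gadget of 0. -/
theorem singleton_sublist_coordGadget_false (v : Bool) :
    [v].Sublist (coordGadget false) := by
  cases v <;> decide

/-- For d ≥ 1 and any b ∈ {0,1}^d, the binary string p'(b) is a subsequence of
s'(z), where z is the all-zeros vector. -/
theorem pStr'_sublist_sStr'_zero {d : ℕ} (hd : 1 ≤ d) (b : Fin d → Bool) :
    (pStr' b).Sublist (sStr' (zVec d)) := by
  exact (List.Sublist.refl _).append <| List.flatten_ofFn_sublist fun i =>
    (singleton_sublist_coordGadget_false (b i)).append (List.Sublist.refl _)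
end

section
/- Let d, n, m ≥ 1 with m ≤ n, and let A = (a_1, …, a_n) and B = (b_1, …, b_m) be sequences of vectors in {0,1}^d. Let w = (d²+4d+1)(2m−1)+d+1. Then there exists a substring T of S' of length exactly w such that P' is a subsequence of T. -/
theorem List.flatten_ofFn_sublist_flatten_ofFn {α : Type*} {k : ℕ} {f g : Fin k → List α}
    (h : ∀ i, (f i).Sublist (g i)) :
    (List.ofFn f).flatten.Sublist (List.ofFn g).flatten := by
  induction k with
  | zero => simp
  | succ k ih =>
    simp only [List.ofFn_succ, List.flatten_cons]
    exact (h 0).append (ih fun i => h i.succ)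

theorem List.length_flatten_ofFn_of_length_eq {α : Type*} {k c : ℕ} {f : Fin k → List α}
    (h : ∀ i, (f i).length = c) : (List.ofFn f).flatten.length = k * c := by
  simp [List.length_flatten, List.map_ofFn, Function.comp_def, h]

theorem pStr'_sublist_sStr'_zVec {d : ℕ} (b : Fin d → Bool) :
    (pStr' b).Sublist (sStr' (zVec d)) := by
  refine (List.Sublist.refl _).append (List.flatten_ofFn_sublist_flatten_ofFn fun i => ?_)
  refine List.Sublist.append ?_ (List.Sublist.refl _)
  cases b i <;> simp [zVec, coordGadget]

theorem length_sStr' {d : ℕ} (a : Fin d → Bool) : (sStr' a).length = d + d * (d + 2) := by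
  have h : ∀ i, (coordGadget (a i) ++ innerSep d).length = d + 2 := fun i => by
    cases a i <;> simp [coordGadget, innerSep]
  rw [sStr', List.length_append, List.length_flatten_ofFn_of_length_eq h]
  simp [innerSep]

theorem length_Shalf' {d n : ℕ} (A : Fin n → Fin d → Bool) :
    (Shalf' A).length = n * (2 * (d ^ 2 + 4 * d + 1)) :=
  List.length_flatten_ofFn_of_length_eq fun i => by
    simp only [List.length_append, length_sStr', outerSep, List.length_replicate]
    ring

theorem Shalf'_castAdd_prefix {d k l : ℕ} (A : Fin (k + l) → Fin d → Bool) :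
    Shalf' (fun i => A (Fin.castAdd l i)) <+: Shalf' A := by
  simp only [Shalf', List.ofFn_add, List.flatten_append]
  exact List.prefix_append _ _

/-- For d, n, m ≥ 1 with m ≤ n and w = (d²+4d+1)(2m−1)+d+1, there exists a
substring T of S' of length exactly w such that P' is a subsequence of T. -/
theorem exists_substring_length_eq_w {d n m : ℕ} (hd : 1 ≤ d) (hn : 1 ≤ n)
    (hm : 1 ≤ m) (hmn : m ≤ n)
    (A : Fin n → Fin d → Bool) (B : Fin m → Fin d → Bool) :
    ∃ T : List Bool, T <:+: Sstr' A ∧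
      T.length = (d ^ 2 + 4 * d + 1) * (2 * m - 1) + d + 1 ∧
      (Pstr' B).Sublist T := by
  obtain ⟨k, rfl⟩ := Nat.exists_eq_add_of_le' hm
  obtain ⟨l, rfl⟩ := Nat.exists_eq_add_of_le (Nat.le_of_succ_le hmn)
  refine ⟨outerSep d ++ sStr' (zVec d) ++ outerSep d ++ Shalf' (fun i => A (Fin.castAdd l i)),
    ?_, ?_, ?_⟩
  · exact (((List.prefix_append_right_inj _).2 (Shalf'_castAdd_prefix A)).trans
      (List.prefix_append _ _)).isInfix
  · have hk : 2 * (k + 1) - 1 = 2 * k + 1 := by omega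
    simp only [List.length_append, length_sStr', length_Shalf', outerSep,
      List.length_replicate, hk]
    ring
  · simp only [Pstr', List.ofFn_succ, List.flatten_cons, ← List.append_assoc]
    refine List.Sublist.append ?_ (List.flatten_ofFn_sublist_flatten_ofFn fun i => ?_)
    · exact ((List.Sublist.refl _).append (pStr'_sublist_sStr'_zVec _)).append
        (List.Sublist.refl _)
    · exact ((pStr'_sublist_sStr'_zVec _).trans (List.sublist_append_right _ _)).append
        (List.Sublist.refl _)
end
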